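/- arXiv:math/0312106 — 2 statements merged into one kernel-verified Lean document; each statement's English description precedes it below -/
import Mathlib

section
/- The 140 weight-4 codewords of the Hamming code H_16 form a Steiner system S(3,4,16): for every 3-element subset T of the 16 coordinate positions there is exactly one weight-4 codeword of H_16 whose support contains T. -/
open Finset
open scoped Classical

/-- Rows spanning the first-order Reed-Muller code RM(1,4) of length 16. -/
def r1 : Fin 16 → ZMod 2 := fun _ => 1
def r2 : Fin 16 → ZMod 2 := fun i => if i.val < 8 then 1 else 0
def r3 : Fin 16 → ZMod 2 := fun i => if i.val % 8 < 4 then 1 else 0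
def r4 : Fin 16 → ZMod 2 := fun i => if i.val % 4 < 2 then 1 else 0
def r5 : Fin 16 → ZMod 2 := fun i => if i.val % 2 = 0 then 1 else 0

/-- The first-order Reed-Muller code RM(1,4) ⊂ F₂¹⁶. -/
def RM : Submodule (ZMod 2) (Fin 16 → ZMod 2) :=
  Submodule.span (ZMod 2) {r1, r2, r3, r4, r5}

/-- The Hamming code H₁₆, the dual code of RM(1,4). -/
def H16 : Submodule (ZMod 2) (Fin 16 → ZMod 2) where
  carrier := {c | ∀ d ∈ RM, ∑ i, c i * d i = 0}
  zero_mem' := by intro d _; simp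
  add_mem' := by
    intro a b ha hb d hd
    have h1 := ha d hd
    have h2 := hb d hd
    have : ∑ i, (a + b) i * d i = (∑ i, a i * d i) + ∑ i, b i * d i := by
      simp [Pi.add_apply, add_mul, Finset.sum_add_distrib]
    simp only [Set.mem_setOf_eq] at *
    rw [this, h1, h2, add_zero]
  smul_mem' := by
    intro m a ha d hd
    have h1 := ha d hd
    have : ∑ i, (m • a) i * d i = m * ∑ i, a i * d i := by
      simp [Pi.smul_apply, smul_eq_mul, mul_assoc, Finset.mul_sum]
    simp only [Set.mem_setOf_eq] at *
    rw [this, h1, mul_zero]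


/-- The coordinates of a position of the code as a point of the affine space `F₂⁴`. -/
def position (i : Fin 16) : Fin 4 → ZMod 2 := ![r2 i, r3 i, r4 i, r5 i]

lemma position_injective : Function.Injective position := by
  unfold Function.Injective
  decide

lemma position_surjective : Function.Surjective position :=
  ((Fintype.bijective_iff_injective_and_card position).2
    ⟨position_injective, by simp [ZMod.card]⟩).2

lemma mem_H16_iff (v : Fin 16 → ZMod 2) :
    v ∈ H16 ↔ ∑ i, v i = 0 ∧ ∑ i, v i • position i = 0 := by
  have hmem : v ∈ H16 ↔ ∀ d ∈ ({r1, r2, r3, r4, r5} : Set (Fin 16 → ZMod 2)),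
      ∑ i, v i * d i = 0 := by
    refine ⟨fun h d hd => h d (Submodule.subset_span hd), fun h d hd => ?_⟩
    induction hd using Submodule.span_induction with
    | mem x hx => exact h x hx
    | zero => simp
    | add x y _ _ hx hy => simp [mul_add, Finset.sum_add_distrib, hx, hy]
    | smul a x _ hx => simp [mul_left_comm _ a, ← Finset.mul_sum, hx]
  rw [hmem, funext_iff]
  simp [Fin.forall_fin_succ, position, r1, Finset.sum_apply]

/-- A binary vector is determined by its support. -/
noncomputable def binarySupport {ι : Type*} [Fintype ι] : (ι → ZMod 2) ≃ Finset ι where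
  toFun v := {i | v i = 1}
  invFun S i := if i ∈ S then 1 else 0
  left_inv v := by
    ext i
    have h : ∀ x : ZMod 2, (if x = 1 then (1 : ZMod 2) else 0) = x := by decide
    simp [h]
  right_inv S := by ext i; simp

lemma mem_binarySupport {ι : Type*} [Fintype ι] (v : ι → ZMod 2) (i : ι) :
    i ∈ binarySupport v ↔ v i = 1 := by
  simp [binarySupport]

lemma hammingNorm_eq_card_binarySupport {ι : Type*} [Fintype ι] (v : ι → ZMod 2) :
    hammingNorm v = (binarySupport v).card := by
  have h : ∀ x : ZMod 2, x ≠ 0 ↔ x = 1 := by decide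
  simp only [hammingNorm, h]
  congr 1

lemma sum_smul_eq_sum_binarySupport {ι M : Type*} [Fintype ι] [AddCommGroup M]
    [Module (ZMod 2) M] (v : ι → ZMod 2) (f : ι → M) :
    ∑ i, v i • f i = ∑ i ∈ binarySupport v, f i := by
  have h : ∀ x : ZMod 2, x = if x = 1 then 1 else 0 := by decide
  rw [← Finset.sum_subset (Finset.subset_univ (binarySupport v))]
  · refine Finset.sum_congr rfl fun i hi => ?_
    rw [(mem_binarySupport v i).1 hi, one_smul]
  · intro i _ hi
    rw [mem_binarySupport] at hi
    rw [h (v i), if_neg hi, zero_smul]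

/-- The affine planes of `F₂⁴`: the four-element sets of positions that sum to zero. -/
def IsPlane (S : Finset (Fin 16)) : Prop := S.card = 4 ∧ ∑ i ∈ S, position i = 0

lemma isPlane_binarySupport (v : Fin 16 → ZMod 2) :
    IsPlane (binarySupport v) ↔ v ∈ H16 ∧ hammingNorm v = 4 := by
  have h : (4 : ZMod 2) = 0 := by decide
  have hs := sum_smul_eq_sum_binarySupport v (fun _ => (1 : ZMod 2))
  simp only [smul_eq_mul, mul_one, Finset.sum_const, nsmul_eq_mul] at hs
  rw [mem_H16_iff, hammingNorm_eq_card_binarySupport, sum_smul_eq_sum_binarySupport, hs, IsPlane]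
  constructor
  · rintro ⟨h4, h0⟩
    exact ⟨⟨by rw [h4]; exact h, h0⟩, h4⟩
  · rintro ⟨⟨_, h0⟩, h4⟩
    exact ⟨h4, h0⟩

/-- Three distinct points of `F₂⁴` lie on exactly one plane. -/
lemma existsUnique_isPlane_superset {T : Finset (Fin 16)} (hT : T.card = 3) :
    ∃! S, IsPlane S ∧ T ⊆ S := by
  obtain ⟨d, hd⟩ := position_surjective (∑ i ∈ T, position i)
  have hdT : d ∉ T := by
    intro hmem
    rw [← Finset.add_sum_erase T position hmem, left_eq_add] at hd
    obtain ⟨x, y, hxy, he⟩ := Finset.card_eq_two.1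
      (show (T.erase d).card = 2 by rw [Finset.card_erase_of_mem hmem, hT])
    rw [he, Finset.sum_pair hxy] at hd
    exact hxy (position_injective (CharTwo.add_eq_zero.1 hd))
  refine ⟨insert d T, ⟨⟨?_, ?_⟩, Finset.subset_insert d T⟩, ?_⟩
  · rw [Finset.card_insert_of_notMem hdT, hT]
  · rw [Finset.sum_insert hdT, hd, CharTwo.add_self_eq_zero]
  · rintro S ⟨⟨hS, h0⟩, hTS⟩
    obtain ⟨x, hx⟩ := Finset.card_eq_one.1
      (show (S \ T).card = 1 by rw [Finset.card_sdiff_of_subset hTS, hS, hT])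
    rw [← Finset.sum_sdiff hTS, hx, Finset.sum_singleton, ← hd] at h0
    rw [← Finset.sdiff_union_of_subset hTS, hx, position_injective (CharTwo.add_eq_zero.1 h0),
      Finset.insert_eq]

/-- Count the pairs of a plane and a triple of points on it in two ways. -/
lemma card_isPlane : (Finset.univ.filter IsPlane).card = 140 := by
  have h := Finset.card_mul_eq_card_mul (s := Finset.univ.filter IsPlane)
    (t := Finset.powersetCard 3 (Finset.univ : Finset (Fin 16))) (fun S T => T ⊆ S)
    (m := 4) (n := 1) ?_ ?_
  · rw [Finset.card_powersetCard, Finset.card_univ, Fintype.card_fin,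
      show Nat.choose 16 3 = 560 by decide] at h
    omega
  · intro S hS
    have h4 : S.card = 4 := (Finset.mem_filter.1 hS).2.1
    have he : Finset.bipartiteAbove (fun S T : Finset (Fin 16) => T ⊆ S)
        (Finset.powersetCard 3 Finset.univ) S = Finset.powersetCard 3 S := by
      ext T
      simp [Finset.mem_bipartiteAbove, Finset.mem_powersetCard, and_comm]
    rw [he, Finset.card_powersetCard, h4]
    rfl
  · intro T hT
    obtain ⟨S, hS, huniq⟩ := existsUnique_isPlane_superset (Finset.mem_powersetCard.1 hT).2
    refine Finset.card_eq_one.2 ⟨S, Finset.eq_singleton_iff_unique_mem.2 ⟨?_, fun S' hS' => ?_⟩⟩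
    · simpa [Finset.mem_bipartiteBelow] using hS
    · exact huniq S' (by simpa [Finset.mem_bipartiteBelow] using hS')

/-- The 140 weight-4 codewords of H₁₆ form a Steiner system S(3,4,16). -/
theorem h16_steiner_system :
    (Finset.univ.filter
        (fun v : Fin 16 → ZMod 2 => v ∈ H16 ∧ hammingNorm v = 4)).card = 140 ∧
    ∀ T : Finset (Fin 16), T.card = 3 →
      ∃! v : Fin 16 → ZMod 2, v ∈ H16 ∧ hammingNorm v = 4 ∧ ∀ i ∈ T, v i = 1 := by
  constructor
  · rw [← card_isPlane]
    exact Finset.card_equiv binarySupport fun v => by simp [isPlane_binarySupport]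
  · intro T hT
    refine (binarySupport.existsUnique_congr fun {v} => ?_).2 (existsUnique_isPlane_superset hT)
    simp only [isPlane_binarySupport, and_assoc, Finset.subset_iff, mem_binarySupport]
end

section
/- For any weight-1 vector c ∈ F_2^16, the weight enumerator of the coset H_16 + c equals (1/32)((x+y)^16 − (x−y)^16) = x^15 y + x y^15 + 35(x^13 y^3 + x^3 y^13) + 273(x^11 y^5 + x^5 y^11) + 715(x^9 y^7 + x^7 y^9). -/
open Finset
open scoped Classical

/-- The nontrivial additive character of `ZMod 2`, as an integer-valued sign. -/
def binarySign (z : ZMod 2) : ℤ := if z = 0 then 1 else -1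

theorem binarySign_add (a b : ZMod 2) :
    binarySign (a + b) = binarySign a * binarySign b := by
  revert a b; decide

theorem binarySign_sub (a b : ZMod 2) :
    binarySign (a - b) = binarySign a * binarySign b := by
  revert a b; decide

theorem binarySign_sum {ι : Type*} (s : Finset ι) (f : ι → ZMod 2) :
    binarySign (∑ i ∈ s, f i) = ∏ i ∈ s, binarySign (f i) := by
  classical
  induction s using Finset.induction_on with
  | empty => simp [binarySign]
  | insert i s hi ih => rw [sum_insert hi, prod_insert hi, binarySign_add, ih]

/-- The linear combination of the rows of `RM` with coefficient `s` at the all-one row and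
coefficients `a` at the other rows. -/
def rmWord (s : ZMod 2) (a : ZMod 2 × ZMod 2 × ZMod 2 × ZMod 2) (i : Fin 16) : ZMod 2 :=
  s + (a.1 * r2 i + a.2.1 * r3 i + a.2.2.1 * r4 i + a.2.2.2 * r5 i)

theorem mem_H16_iff_s7 (u : Fin 16 → ZMod 2) :
    u ∈ H16 ↔ (∑ i, u i * r1 i = 0) ∧ (∑ i, u i * r2 i = 0) ∧ (∑ i, u i * r3 i = 0) ∧
      (∑ i, u i * r4 i = 0) ∧ (∑ i, u i * r5 i = 0) := by
  constructor
  · intro h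
    have key : ∀ r ∈ ({r1, r2, r3, r4, r5} : Set (Fin 16 → ZMod 2)), ∑ i, u i * r i = 0 :=
      fun r hr => h r (Submodule.subset_span hr)
    exact ⟨key _ (by simp), key _ (by simp), key _ (by simp), key _ (by simp), key _ (by simp)⟩
  · rintro ⟨h1, h2, h3, h4, h5⟩ d hd
    induction hd using Submodule.span_induction with
    | mem r hr =>
      simp only [Set.mem_insert_iff, Set.mem_singleton_iff] at hr
      rcases hr with rfl | rfl | rfl | rfl | rfl
      exacts [h1, h2, h3, h4, h5]
    | zero => simp
    | add a b _ _ ha hb => simp [mul_add, sum_add_distrib, ha, hb]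
    | smul m a _ ha => simp [mul_left_comm, ← mul_sum, ha]

theorem sum_binarySign_linear (t₁ t₂ t₃ t₄ t₅ : ZMod 2) :
    ∑ a : ZMod 2 × ZMod 2 × ZMod 2 × ZMod 2, ∑ s : ZMod 2,
      binarySign (s * t₁ + (a.1 * t₂ + a.2.1 * t₃ + a.2.2.1 * t₄ + a.2.2.2 * t₅)) =
      if t₁ = 0 ∧ t₂ = 0 ∧ t₃ = 0 ∧ t₄ = 0 ∧ t₅ = 0 then 32 else 0 := by
  revert t₁ t₂ t₃ t₄ t₅; decide +kernel

theorem sum_mul_rmWord (u : Fin 16 → ZMod 2) (s : ZMod 2)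
    (a : ZMod 2 × ZMod 2 × ZMod 2 × ZMod 2) :
    ∑ i, u i * rmWord s a i = s * (∑ i, u i * r1 i) + (a.1 * (∑ i, u i * r2 i) +
      a.2.1 * (∑ i, u i * r3 i) + a.2.2.1 * (∑ i, u i * r4 i) +
      a.2.2.2 * (∑ i, u i * r5 i)) := by
  simp only [mul_sum, ← sum_add_distrib]
  refine sum_congr rfl fun i _ => ?_
  simp only [rmWord, r1]
  ring

/-- Orthogonality of characters for the dual of `RM`. -/
theorem sum_binarySign_rmWord (u : Fin 16 → ZMod 2) :
    ∑ a : ZMod 2 × ZMod 2 × ZMod 2 × ZMod 2, ∑ s : ZMod 2,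
      binarySign (∑ i, u i * rmWord s a i) = if u ∈ H16 then 32 else 0 := by
  simp only [sum_mul_rmWord, sum_binarySign_linear, mem_H16_iff_s7]

theorem hammingNorm_rmWord {a : ZMod 2 × ZMod 2 × ZMod 2 × ZMod 2} (ha : a ≠ 0) (s : ZMod 2) :
    hammingNorm (rmWord s a) = 8 := by
  revert s a; decide +kernel

theorem prod_ite_ne_zero {ι R : Type*} [Fintype ι] [CommRing R] (v : ι → ZMod 2) (a b : R) :
    ∏ i, (if v i ≠ 0 then a else b) =
      b ^ (Fintype.card ι - hammingNorm v) * a ^ hammingNorm v := by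
  rw [prod_ite, prod_const, prod_const, mul_comm, filter_not,
    card_sdiff_of_subset (filter_subset _ _), card_univ]
  rfl

theorem prod_add_binarySign_mul {ι R : Type*} [Fintype ι] [CommRing R] (x y : R)
    (d : ι → ZMod 2) :
    ∏ i, (x + (binarySign (d i) : R) * y) =
      (x + y) ^ (Fintype.card ι - hammingNorm d) * (x - y) ^ hammingNorm d := by
  have h : ∀ i, x + (binarySign (d i) : R) * y = if d i ≠ 0 then x - y else x + y := by
    intro i
    by_cases hi : d i = 0 <;> simp [binarySign, hi, sub_eq_add_neg]
  simp only [h, prod_ite_ne_zero]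

/-- The character transform of the weight monomials on binary words. -/
theorem sum_weight_mul_binarySign {ι R : Type*} [Fintype ι] [DecidableEq ι] [CommRing R]
    (x y : R) (d : ι → ZMod 2) :
    ∑ v : ι → ZMod 2, x ^ (Fintype.card ι - hammingNorm v) * y ^ hammingNorm v *
        (binarySign (∑ i, v i * d i) : R) =
      (x + y) ^ (Fintype.card ι - hammingNorm d) * (x - y) ^ hammingNorm d := by
  rw [← prod_add_binarySign_mul]
  have h : ∀ i, x + (binarySign (d i) : R) * y =
      ∑ z : ZMod 2, (if z ≠ 0 then y else x) * (binarySign (z * d i) : R) := by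
    intro i
    rw [show (univ : Finset (ZMod 2)) = {0, 1} from rfl, sum_pair (by decide)]
    simp [binarySign, mul_comm]
  simp only [h]
  rw [Fintype.prod_sum]
  refine sum_congr rfl fun v _ => ?_
  rw [binarySign_sum, Int.cast_prod, prod_mul_distrib]
  congr 1
  exact (prod_ite_ne_zero v y x).symm

theorem exists_eq_single_of_hammingNorm_eq_one {ι : Type*} [Fintype ι] [DecidableEq ι]
    {c : ι → ZMod 2} (hc : hammingNorm c = 1) : ∃ k, c = Pi.single k 1 := by
  obtain ⟨k, hk⟩ := card_eq_one.mp hc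
  have hmem : ∀ i, c i ≠ 0 ↔ i = k := fun i => by
    simpa using Finset.ext_iff.mp hk i
  refine ⟨k, funext fun i => ?_⟩
  have hz : ∀ z : ZMod 2, z ≠ 0 → z = 1 := by decide
  by_cases hi : i = k
  · subst hi
    simpa using hz _ ((hmem i).mpr rfl)
  · simpa [hi] using not_not.mp (mt (hmem i).mp hi)

theorem sum_binarySign_coset (v : Fin 16 → ZMod 2) (k : Fin 16) :
    ∑ a : ZMod 2 × ZMod 2 × ZMod 2 × ZMod 2, ∑ s : ZMod 2,
      binarySign (∑ i, v i * rmWord s a i) * binarySign (rmWord s a k) =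
      if v - Pi.single k 1 ∈ H16 then 32 else 0 := by
  rw [← sum_binarySign_rmWord]
  refine sum_congr rfl fun a _ => sum_congr rfl fun s _ => ?_
  rw [← binarySign_sub]
  simp [sub_mul, sum_sub_distrib, Pi.single_apply]

/-- The MacWilliams transform for a coset of `H16` with a weight-one representative. -/
theorem mul_sum_coset_eq_sum_rmWord {R : Type*} [CommRing R] (x y : R) (k : Fin 16) :
    (32 : R) * (∑ v ∈ Finset.univ.filter
      (fun v : Fin 16 → ZMod 2 => v - Pi.single k 1 ∈ H16),
        x ^ (16 - hammingNorm v) * y ^ (hammingNorm v)) =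
      ∑ a : ZMod 2 × ZMod 2 × ZMod 2 × ZMod 2, ∑ s : ZMod 2,
        (x + y) ^ (16 - hammingNorm (rmWord s a)) * (x - y) ^ hammingNorm (rmWord s a) *
          (binarySign (rmWord s a k) : R) := by
  have htransform := fun d => sum_weight_mul_binarySign x y (ι := Fin 16) d
  simp only [Fintype.card_fin] at htransform
  simp only [← htransform, sum_mul]
  rw [sum_filter, mul_sum]
  rw [sum_congr rfl fun a _ => sum_comm, sum_comm]
  refine sum_congr rfl fun v _ => ?_
  generalize x ^ (16 - hammingNorm v) * y ^ hammingNorm v = m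
  have hv := congrArg (Int.cast : ℤ → R) (sum_binarySign_coset v k)
  simp only [Int.cast_sum, Int.cast_mul] at hv
  simp only [mul_assoc, ← mul_sum]
  rw [hv]
  split_ifs
  · push_cast
    ring
  · simp

/-- The enumerator of an odd coset of `H16`, scaled by the order of `RM`. -/
theorem mul_sum_coset_H16 {R : Type*} [CommRing R] (x y : R)
    (c : Fin 16 → ZMod 2) (hc : hammingNorm c = 1) :
    (32 : R) * (∑ v ∈ Finset.univ.filter (fun v : Fin 16 → ZMod 2 => v - c ∈ H16),
        x ^ (16 - hammingNorm v) * y ^ (hammingNorm v))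
      = (x + y) ^ 16 - (x - y) ^ 16 := by
  obtain ⟨k, rfl⟩ := exists_eq_single_of_hammingNorm_eq_one hc
  rw [mul_sum_coset_eq_sum_rmWord, Fintype.sum_eq_single 0]
  · have h0 : rmWord 0 0 = fun _ => 0 := by ext i; simp [rmWord]
    have h1 : rmWord 1 0 = fun _ => 1 := by ext i; simp [rmWord]
    rw [show (univ : Finset (ZMod 2)) = {0, 1} from rfl, sum_pair (by decide), h0, h1]
    simp [hammingNorm, binarySign, sub_eq_add_neg]
  · intro a ha
    simp only [hammingNorm_rmWord ha]
    rw [← mul_sum, ← Int.cast_sum]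
    have hz : ∀ t : ZMod 2, ∑ s : ZMod 2, binarySign (s + t) = 0 := by decide
    simp only [rmWord, hz, Int.cast_zero, mul_zero]

/-- The weight enumerator of a coset of H₁₆ with a weight-1
representative equals (1/32)((x+y)¹⁶ − (x−y)¹⁶), with the stated expansion. -/
theorem h16_odd_coset_enumerator (R : Type*) [CommRing R] (x y : R)
    (c : Fin 16 → ZMod 2) (hc : hammingNorm c = 1) :
    (32 : R) * (∑ v ∈ Finset.univ.filter (fun v : Fin 16 → ZMod 2 => v - c ∈ H16),
        x ^ (16 - hammingNorm v) * y ^ (hammingNorm v))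
      = (x + y) ^ 16 - (x - y) ^ 16 ∧
    (∑ v ∈ Finset.univ.filter (fun v : Fin 16 → ZMod 2 => v - c ∈ H16),
        x ^ (16 - hammingNorm v) * y ^ (hammingNorm v))
      = x ^ 15 * y + x * y ^ 15 + 35 * (x ^ 13 * y ^ 3 + x ^ 3 * y ^ 13)
        + 273 * (x ^ 11 * y ^ 5 + x ^ 5 * y ^ 11)
        + 715 * (x ^ 9 * y ^ 7 + x ^ 7 * y ^ 9) := by
  refine ⟨mul_sum_coset_H16 x y c hc, ?_⟩
  have h := mul_sum_coset_H16 (MvPolynomial.X 0 : MvPolynomial (Fin 2) ℤ) (MvPolynomial.X 1) c hc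
  have h32 : (32 : MvPolynomial (Fin 2) ℤ) ≠ 0 := by norm_num
  have hgeneric := mul_left_cancel₀ h32 (h.trans (c := 32 * (
    MvPolynomial.X 0 ^ 15 * MvPolynomial.X 1 + MvPolynomial.X 0 * MvPolynomial.X 1 ^ 15 +
      35 * (MvPolynomial.X 0 ^ 13 * MvPolynomial.X 1 ^ 3 +
        MvPolynomial.X 0 ^ 3 * MvPolynomial.X 1 ^ 13) +
      273 * (MvPolynomial.X 0 ^ 11 * MvPolynomial.X 1 ^ 5 +
        MvPolynomial.X 0 ^ 5 * MvPolynomial.X 1 ^ 11) +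
      715 * (MvPolynomial.X 0 ^ 9 * MvPolynomial.X 1 ^ 7 +
        MvPolynomial.X 0 ^ 7 * MvPolynomial.X 1 ^ 9))) (by ring))
  simpa using congrArg (MvPolynomial.aeval ![x, y]) hgeneric
end
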